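/- arXiv:2205.02183 — 8 statements merged into one kernel-verified Lean document; each statement's English description precedes it below -/
import Mathlib

section
/- For any vectors v_{i,j} = (α_{i,j}, β_{i,j}) ∈ k² (1 ≤ i < j ≤ 4), det^{S²}((v_{i,j})_{1≤i<j≤4}) equals the determinant of the 6×6 matrix whose rows are (α_{1,2}, α_{2,3}, 0, −α_{1,3}, 0, 0), (β_{1,2}, β_{2,3}, 0, −β_{1,3}, 0, 0), (α_{1,2}, 0, 0, 0, α_{2,4}, −α_{1,4}), (β_{1,2}, 0, 0, 0, β_{2,4}, −β_{1,4}), (0, 0, α_{3,4}, α_{1,3}, 0, −α_{1,4}), (0, 0, β_{3,4}, β_{1,3}, 0, −β_{1,4}). -/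
/-- The `det^{S²}` map on six vectors `v_{i,j} ∈ k²`, `1 ≤ i < j ≤ 4`,
indexed here by `i j : Fin 4` (pair `(i,j)` of the paper corresponds to `(i-1, j-1)`). -/
def detS2 {k : Type*} [Field k] (v : Fin 4 → Fin 4 → k × k) : k :=
  (v 0 1).1 * (v 1 2).1 * (v 2 3).1 * (v 0 2).2 * (v 1 3).2 * (v 0 3).2
  + (v 0 1).1 * (v 1 2).2 * (v 2 3).1 * (v 0 2).2 * (v 1 3).2 * (v 0 3).1
  + (v 0 1).1 * (v 1 2).2 * (v 2 3).2 * (v 0 2).1 * (v 1 3).1 * (v 0 3).2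
  + (v 0 1).2 * (v 1 2).2 * (v 2 3).1 * (v 0 2).1 * (v 1 3).1 * (v 0 3).2
  + (v 0 1).2 * (v 1 2).1 * (v 2 3).2 * (v 0 2).2 * (v 1 3).1 * (v 0 3).1
  + (v 0 1).2 * (v 1 2).1 * (v 2 3).2 * (v 0 2).1 * (v 1 3).2 * (v 0 3).1
  - (v 0 1).2 * (v 1 2).2 * (v 2 3).2 * (v 0 2).1 * (v 1 3).1 * (v 0 3).1
  - (v 0 1).2 * (v 1 2).1 * (v 2 3).2 * (v 0 2).1 * (v 1 3).1 * (v 0 3).2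
  - (v 0 1).2 * (v 1 2).1 * (v 2 3).1 * (v 0 2).2 * (v 1 3).2 * (v 0 3).1
  - (v 0 1).1 * (v 1 2).1 * (v 2 3).2 * (v 0 2).2 * (v 1 3).2 * (v 0 3).1
  - (v 0 1).1 * (v 1 2).2 * (v 2 3).1 * (v 0 2).1 * (v 1 3).2 * (v 0 3).2
  - (v 0 1).1 * (v 1 2).2 * (v 2 3).1 * (v 0 2).2 * (v 1 3).1 * (v 0 3).2


/-- `det^{S²}` equals the determinant of the associated `6 × 6` matrix. -/
theorem detS2_eq_det_six_by_six {k : Type*} [Field k] [CharZero k]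
    (v : Fin 4 → Fin 4 → k × k) :
    detS2 v = Matrix.det (Matrix.of
      ![![(v 0 1).1, (v 1 2).1, 0, -(v 0 2).1, 0, 0],
        ![(v 0 1).2, (v 1 2).2, 0, -(v 0 2).2, 0, 0],
        ![(v 0 1).1, 0, 0, 0, (v 1 3).1, -(v 0 3).1],
        ![(v 0 1).2, 0, 0, 0, (v 1 3).2, -(v 0 3).2],
        ![0, 0, (v 2 3).1, (v 0 2).1, 0, -(v 0 3).1],
        ![0, 0, (v 2 3).2, (v 0 2).2, 0, -(v 0 3).2]]) := by
  simp [detS2, Matrix.det_succ_row_zero, Fin.sum_univ_succ, Fin.succAbove]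
  ring
end

section
/- Let v_{i,j} ∈ ℝ² for 1 ≤ i < j ≤ 4. If there exist four points Q₁, Q₂, Q₃, Q₄ ∈ ℝ² and scalars λ_{i,j} ∈ ℝ for 1 ≤ i < j ≤ 4, not all zero, such that λ_{i,j} v_{i,j} = Q_j − Q_i for all 1 ≤ i < j ≤ 4, then det^{S²}((v_{i,j})_{1≤i<j≤4}) = 0. -/
/-- The coefficient matrix of the six scalar equations in the unknowns `l i j`, ordered as
`(0,1), (0,2), (0,3), (1,2), (1,3), (2,3)`, which say that the vectors `l i j • v i j` close up
along each of the triangles `{0,1,2}`, `{0,1,3}` and `{0,2,3}`. -/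
def triangleMatrix {k : Type*} [Field k] (v : Fin 4 → Fin 4 → k × k) :
    Matrix (Fin 6) (Fin 6) k :=
  !![(v 0 1).1, -(v 0 2).1, 0, (v 1 2).1, 0, 0;
     (v 0 1).2, -(v 0 2).2, 0, (v 1 2).2, 0, 0;
     (v 0 1).1, 0, -(v 0 3).1, 0, (v 1 3).1, 0;
     (v 0 1).2, 0, -(v 0 3).2, 0, (v 1 3).2, 0;
     0, (v 0 2).1, -(v 0 3).1, 0, 0, (v 2 3).1;
     0, (v 0 2).2, -(v 0 3).2, 0, 0, (v 2 3).2]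

theorem det_triangleMatrix {k : Type*} [Field k] (v : Fin 4 → Fin 4 → k × k) :
    (triangleMatrix v).det = detS2 v := by
  simp [triangleMatrix, detS2, Matrix.det_succ_row_zero, Fin.sum_univ_succ, Fin.succAbove]
  ring

/-- If six scalars, not all zero, scale the vectors `v i j` so that they are the differences of
four points, then the triangle equations have a nontrivial solution. -/
theorem det_triangleMatrix_eq_zero {k : Type*} [Field k] (v : Fin 4 → Fin 4 → k × k)
    (Q : Fin 4 → k × k) (l : Fin 4 → Fin 4 → k)
    (hne : ∃ i j : Fin 4, i < j ∧ l i j ≠ 0)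
    (h : ∀ i j : Fin 4, i < j → l i j • v i j = Q j - Q i) :
    (triangleMatrix v).det = 0 := by
  have hfst (i j : Fin 4) (hij : i < j) : l i j * (v i j).1 = (Q j).1 - (Q i).1 :=
    congrArg Prod.fst (h i j hij)
  have hsnd (i j : Fin 4) (hij : i < j) : l i j * (v i j).2 = (Q j).2 - (Q i).2 :=
    congrArg Prod.snd (h i j hij)
  refine Matrix.exists_mulVec_eq_zero_iff.mp
    ⟨![l 0 1, l 0 2, l 0 3, l 1 2, l 1 3, l 2 3], ?_, ?_⟩
  · intro hl
    obtain ⟨i, j, hij, hlij⟩ := hne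
    have hl' (n : Fin 6) := congrFun hl n
    simp only [Fin.forall_fin_succ] at hl'
    fin_cases i <;> fin_cases j <;> simp_all
  · have h01 := hfst 0 1 (by decide)
    have h02 := hfst 0 2 (by decide)
    have h03 := hfst 0 3 (by decide)
    have h12 := hfst 1 2 (by decide)
    have h13 := hfst 1 3 (by decide)
    have h23 := hfst 2 3 (by decide)
    have k01 := hsnd 0 1 (by decide)
    have k02 := hsnd 0 2 (by decide)
    have k03 := hsnd 0 3 (by decide)
    have k12 := hsnd 1 2 (by decide)
    have k13 := hsnd 1 3 (by decide)
    have k23 := hsnd 2 3 (by decide)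
    ext n
    fin_cases n <;> simp [triangleMatrix, Matrix.mulVec, dotProduct, Fin.sum_univ_succ]
    · linear_combination h01 - h02 + h12
    · linear_combination k01 - k02 + k12
    · linear_combination h01 - h03 + h13
    · linear_combination k01 - k03 + k13
    · linear_combination h02 - h03 + h23
    · linear_combination k02 - k03 + k23

/-- If there are four points `Q₁, Q₂, Q₃, Q₄ ∈ ℝ²` and scalars `λ_{i,j}`, not all zero,
with `λ_{i,j} v_{i,j} = Q_j - Q_i` for all `i < j`, then `det^{S²}(v) = 0`. -/
theorem detS2_eq_zero_of_points (v : Fin 4 → Fin 4 → ℝ × ℝ)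
    (Q : Fin 4 → ℝ × ℝ) (l : Fin 4 → Fin 4 → ℝ)
    (hne : ∃ i j : Fin 4, i < j ∧ l i j ≠ 0)
    (h : ∀ i j : Fin 4, i < j → l i j • v i j = Q j - Q i) :
    detS2 v = 0 := by
  rw [← det_triangleMatrix]
  exact det_triangleMatrix_eq_zero v Q l hne h
end

section
/- Let v_{i,j} ∈ ℝ² for 1 ≤ i < j ≤ 4. Then det^{S²}((v_{i,j})_{1≤i<j≤4}) = 0 if and only if there exist four points Q₁, Q₂, Q₃, Q₄ ∈ ℝ² and scalars λ_{i,j} ∈ ℝ for 1 ≤ i < j ≤ 4, not all zero, such that λ_{i,j} v_{i,j} = Q_j − Q_i for all 1 ≤ i < j ≤ 4. -/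
theorem triangleMatrix_mulVec_eq_zero_iff {k : Type*} [Field k] (v : Fin 4 → Fin 4 → k × k)
    (x : Fin 6 → k) :
    (triangleMatrix v).mulVec x = 0 ↔
      x 3 • v 1 2 = x 1 • v 0 2 - x 0 • v 0 1 ∧
      x 4 • v 1 3 = x 2 • v 0 3 - x 0 • v 0 1 ∧
      x 5 • v 2 3 = x 2 • v 0 3 - x 1 • v 0 2 := by
  simp only [funext_iff, Fin.forall_fin_succ, triangleMatrix, Matrix.mulVec, dotProduct,
    Fin.sum_univ_succ, Prod.ext_iff]
  simp
  grind

/-- `det^{S²}(v) = 0` iff there exist four points `Q₁, Q₂, Q₃, Q₄ ∈ ℝ²` and scalars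
`λ_{i,j}`, not all zero, with `λ_{i,j} v_{i,j} = Q_j - Q_i` for all `i < j`. -/
theorem detS2_eq_zero_iff_points (v : Fin 4 → Fin 4 → ℝ × ℝ) :
    detS2 v = 0 ↔
      ∃ (Q : Fin 4 → ℝ × ℝ) (l : Fin 4 → Fin 4 → ℝ),
        (∃ i j : Fin 4, i < j ∧ l i j ≠ 0) ∧
        (∀ i j : Fin 4, i < j → l i j • v i j = Q j - Q i) := by
  rw [← det_triangleMatrix, ← Matrix.exists_mulVec_eq_zero_iff]
  simp only [triangleMatrix_mulVec_eq_zero_iff]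
  constructor
  · rintro ⟨x, hx, h₁₂, h₁₃, h₂₃⟩
    refine ⟨![0, x 0 • v 0 1, x 1 • v 0 2, x 2 • v 0 3],
      ![![0, x 0, x 1, x 2], ![0, 0, x 3, x 4], ![0, 0, 0, x 5], 0], ?_, ?_⟩
    · contrapose! hx
      ext i
      fin_cases i
      · exact hx 0 1 (by decide)
      · exact hx 0 2 (by decide)
      · exact hx 0 3 (by decide)
      · exact hx 1 2 (by decide)
      · exact hx 1 3 (by decide)
      · exact hx 2 3 (by decide)
    · intro i j hij
      fin_cases i <;> fin_cases j <;> first | exact absurd hij (by decide) | simp [*]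
  · rintro ⟨Q, l, ⟨i, j, hij, hl⟩, h⟩
    refine ⟨![l 0 1, l 0 2, l 0 3, l 1 2, l 1 3, l 2 3], ?_, ?_⟩
    · intro h₀
      simp only [funext_iff, Fin.forall_fin_succ] at h₀
      fin_cases i <;> fin_cases j <;> first | exact absurd hij (by decide) | simp_all
    · simp [h]
end

section
/- Let (D, P) be a probability space and let X : D → {1,…,n} and Y : D → {1,…,m} be measurable random variables. Then X and Y are independent, i.e. P(X = i, Y = j) = P(X = i)·P(Y = j) for all 1 ≤ i ≤ n and 1 ≤ j ≤ m, if and only if the n × m joint probability matrix A with entries a_{i,j} = P(X = i, Y = j) has rank equal to 1. -/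
open MeasureTheory

theorem Matrix.exists_eq_vecMulVec_of_rank_eq_one {K ι κ : Type*} [Field K] [Fintype κ]
    [DecidableEq κ] (A : Matrix ι κ K) (hA : A.rank = 1) :
    ∃ (w : ι → K) (v : κ → K), A = Matrix.vecMulVec w v := by
  obtain ⟨w, -, hw⟩ := finrank_eq_one_iff'.mp hA
  choose v hv using fun j : κ =>
    hw ⟨A.mulVecLin (Pi.single j 1), LinearMap.mem_range_self _ _⟩
  refine ⟨w, v, ?_⟩
  ext i j
  have h := congrFun (congrArg Subtype.val (hv j)) i
  simp only [Submodule.coe_smul, Pi.smul_apply, smul_eq_mul, Matrix.mulVecLin_apply,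
    Matrix.mulVec_single_one, Matrix.col_apply] at h
  rw [Matrix.vecMulVec_apply, ← h, mul_comm]

theorem Matrix.rank_eq_one_iff_eq_mul_sum {K ι κ : Type*} [Field K] [Fintype ι] [Fintype κ]
    (A : Matrix ι κ K) (hA : ∑ i, ∑ j, A i j = 1) :
    A.rank = 1 ↔ ∀ i j, A i j = (∑ l, A i l) * ∑ k, A k j := by
  classical
  constructor
  · intro h i j
    obtain ⟨w, v, rfl⟩ := A.exists_eq_vecMulVec_of_rank_eq_one h
    simp only [Matrix.vecMulVec_apply, ← Finset.mul_sum, ← Finset.sum_mul] at hA ⊢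
    linear_combination (-(w i * v j)) * hA
  · intro h
    have hle : A.rank ≤ 1 := by
      rw [show A = Matrix.vecMulVec (fun i => ∑ l, A i l) (fun j => ∑ k, A k j) from
        Matrix.ext h]
      exact Matrix.rank_vecMulVec_le _ _
    have hne : A.rank ≠ 0 := by
      intro h0
      have hbot := Submodule.finrank_eq_zero.mp h0
      have hzero : A = 0 := by
        ext i j
        have := congrFun (LinearMap.congr_fun (LinearMap.range_eq_bot.mp hbot)
          (Pi.single j 1)) i
        simpa using this
      simp [hzero] at hA
    omega

theorem MeasureTheory.sum_measureReal_inter_eq_succ {D : Type*} [MeasurableSpace D]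
    (P : Measure D) [IsFiniteMeasure P] {m : ℕ} {Z : D → ℕ} (hZ : Measurable Z)
    (hZr : ∀ δ, 1 ≤ Z δ ∧ Z δ ≤ m) {S : Set D} (hS : MeasurableSet S) :
    ∑ j : Fin m, P.real (S ∩ {δ | Z δ = (j : ℕ) + 1}) = P.real S := by
  rw [← measureReal_iUnion_fintype]
  · congr 1
    ext δ
    simp only [Set.mem_iUnion, Set.mem_inter_iff, Set.mem_ofPred_eq]
    refine ⟨fun ⟨_, h, _⟩ => h, fun h => ⟨⟨Z δ - 1, ?_⟩, h, ?_⟩⟩ <;>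
      have := hZr δ <;> grind
  · intro a b hab
    refine Set.disjoint_left.mpr fun δ ha hb => hab (Fin.ext ?_)
    have h1 : Z δ = a + 1 := ha.2
    have h2 : Z δ = b + 1 := hb.2
    omega
  · exact fun j => hS.inter (hZ (measurableSet_singleton _))

/-- Two discrete random variables `X : D → {1,…,n}` and `Y : D → {1,…,m}` are independent
(i.e. `P(X = i, Y = j) = P(X = i)·P(Y = j)` for all `i, j`) if and only if the joint
probability matrix `a_{i,j} = P(X = i, Y = j)` has rank `1`. -/
theorem independent_iff_joint_matrix_rank_one
    {D : Type*} [MeasurableSpace D] (P : Measure D) [IsProbabilityMeasure P]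
    (n m : ℕ) (X Y : D → ℕ) (hX : Measurable X) (hY : Measurable Y)
    (hXr : ∀ δ, 1 ≤ X δ ∧ X δ ≤ n) (hYr : ∀ δ, 1 ≤ Y δ ∧ Y δ ≤ m) :
    (∀ i j : ℕ, 1 ≤ i → i ≤ n → 1 ≤ j → j ≤ m →
        P {δ | X δ = i ∧ Y δ = j} = P {δ | X δ = i} * P {δ | Y δ = j}) ↔
      (Matrix.of fun (i : Fin n) (j : Fin m) =>
          (P {δ | X δ = (i : ℕ) + 1 ∧ Y δ = (j : ℕ) + 1}).toReal).rank = 1 := by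
  have hrow (i : Fin n) : ∑ j : Fin m, (P {δ | X δ = (i : ℕ) + 1 ∧ Y δ = (j : ℕ) + 1}).toReal
      = (P {δ | X δ = (i : ℕ) + 1}).toReal :=
    sum_measureReal_inter_eq_succ P hY hYr (hX (measurableSet_singleton _))
  have hcol (j : Fin m) : ∑ i : Fin n, (P {δ | X δ = (i : ℕ) + 1 ∧ Y δ = (j : ℕ) + 1}).toReal
      = (P {δ | Y δ = (j : ℕ) + 1}).toReal := by
    simp only [and_comm (a := X _ = _)]
    exact sum_measureReal_inter_eq_succ P hX hXr (hY (measurableSet_singleton _))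
  have htotal : ∑ i : Fin n, (P {δ | X δ = (i : ℕ) + 1}).toReal = 1 := by
    simpa [Measure.real] using sum_measureReal_inter_eq_succ P hX hXr MeasurableSet.univ
  rw [Matrix.rank_eq_one_iff_eq_mul_sum _ (by simp only [Matrix.of_apply, hrow, htotal])]
  simp only [Matrix.of_apply, hrow, hcol, ← ENNReal.toReal_mul]
  constructor
  · intro h i j
    rw [h _ _ (by omega) (by omega) (by omega) (by omega)]
  · intro h i j hi hin hj hjm
    have := h ⟨i - 1, by omega⟩ ⟨j - 1, by omega⟩
    simp only [Nat.sub_add_cancel hi, Nat.sub_add_cancel hj] at this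
    exact (ENNReal.toReal_eq_toReal_iff' (by finiteness) (by finiteness)).mp this
end

section
/- Let (D, P) be a probability space and X : D → {1,…,s}, Y : D → {1,…,d} measurable random variables with X(δ) > 1 for all δ ∈ D and P(i < X ≤ j) > 0 for all 1 ≤ i < j ≤ s. Then the conditional probability matrix (v_{i,j})_{1≤i<j≤s} has S²-rank equal to 1; that is, for every 1 ≤ x₁ < x₂ < x₃ < x₄ ≤ s and every 1 ≤ a₁ < a₂ ≤ d, det^{S²} applied to the 2-minor w_{i,j} = (v_{x_i,x_j}^{a₁}, v_{x_i,x_j}^{a₂}) ∈ ℝ² (1 ≤ i < j ≤ 4) equals 0. -/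
open MeasureTheory

/-- The distribution weight `λ_{i,j} = P(i < X ≤ j)`. -/
noncomputable def distWeight {D : Type*} [MeasurableSpace D] (P : Measure D)
    (X : D → ℕ) (i j : ℕ) : ℝ :=
  (P {δ | i < X δ ∧ X δ ≤ j}).toReal

/-- Entry `a` of the conditional probability matrix:
`v_{i,j}^a = P(Y = a | i < X ≤ j) = P(Y = a, i < X ≤ j) / P(i < X ≤ j)`. -/
noncomputable def condProb {D : Type*} [MeasurableSpace D] (P : Measure D)
    (X Y : D → ℕ) (i j a : ℕ) : ℝ :=
  (P {δ | Y δ = a ∧ i < X δ ∧ X δ ≤ j}).toReal / distWeight P X i j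

/-- Entry `a` of the distribution vector `p_i`: `p_i^a = P(Y = a, X ≤ i)`. -/
noncomputable def distVec {D : Type*} [MeasurableSpace D] (P : Measure D)
    (X Y : D → ℕ) (i a : ℕ) : ℝ :=
  (P {δ | Y δ = a ∧ X δ ≤ i}).toReal

/-- Additivity of `P(Y = a, i < X ≤ k)` along a splitting of the interval at `j`. -/
theorem toReal_measure_Ioc_add {D : Type*} [MeasurableSpace D] (P : Measure D)
    [IsFiniteMeasure P] {X Y : D → ℕ} (hXm : Measurable X) (hYm : Measurable Y)
    {i j k : ℕ} (hij : i ≤ j) (hjk : j ≤ k) (a : ℕ) :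
    (P {δ | Y δ = a ∧ i < X δ ∧ X δ ≤ k}).toReal =
      (P {δ | Y δ = a ∧ i < X δ ∧ X δ ≤ j}).toReal +
        (P {δ | Y δ = a ∧ j < X δ ∧ X δ ≤ k}).toReal := by
  have hunion : {δ | Y δ = a ∧ i < X δ ∧ X δ ≤ k} =
      {δ | Y δ = a ∧ i < X δ ∧ X δ ≤ j} ∪ {δ | Y δ = a ∧ j < X δ ∧ X δ ≤ k} := by
    ext δ
    simp only [Set.mem_ofPred_eq, Set.mem_union]
    omega
  have hdisj : Disjoint {δ | Y δ = a ∧ i < X δ ∧ X δ ≤ j}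
      {δ | Y δ = a ∧ j < X δ ∧ X δ ≤ k} := by
    rw [Set.disjoint_left]
    rintro δ ⟨-, -, h⟩ ⟨-, h', -⟩
    omega
  have hmeas : MeasurableSet {δ | Y δ = a ∧ j < X δ ∧ X δ ≤ k} :=
    (hYm (measurableSet_singleton a)).inter (hXm (measurableSet_Ioc (a := j) (b := k)))
  rw [hunion, measure_union hdisj hmeas,
    ENNReal.toReal_add (measure_ne_top _ _) (measure_ne_top _ _)]

/-- The conditional probability matrix has `S²`-rank equal to `1`: every `2`-minor
(given by rows `a₁ < a₂` and column indices `x₁ < x₂ < x₃ < x₄`) has `det^{S²}` zero. -/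
theorem condProb_S2_rank_one
    {D : Type*} [MeasurableSpace D] (P : Measure D) [IsProbabilityMeasure P]
    (s d : ℕ) (X Y : D → ℕ) (hXm : Measurable X) (hYm : Measurable Y)
    (hX : ∀ δ, 1 < X δ ∧ X δ ≤ s) (hY : ∀ δ, 1 ≤ Y δ ∧ Y δ ≤ d)
    (hpos : ∀ i j : ℕ, 1 ≤ i → i < j → j ≤ s → 0 < P {δ | i < X δ ∧ X δ ≤ j}) :
    ∀ x₁ x₂ x₃ x₄ : ℕ, 1 ≤ x₁ → x₁ < x₂ → x₂ < x₃ → x₃ < x₄ → x₄ ≤ s →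
    ∀ a₁ a₂ : ℕ, 1 ≤ a₁ → a₁ < a₂ → a₂ ≤ d →
      detS2 (fun p q : Fin 4 =>
        (condProb P X Y (![x₁, x₂, x₃, x₄] p) (![x₁, x₂, x₃, x₄] q) a₁,
         condProb P X Y (![x₁, x₂, x₃, x₄] p) (![x₁, x₂, x₃, x₄] q) a₂)) = 0 := by
  intro x₁ x₂ x₃ x₄ _ h₁₂ h₂₃ h₃₄ _ a₁ a₂ _ _ _
  have h₁₃ := toReal_measure_Ioc_add P hXm hYm h₁₂.le h₂₃.le
  have h₂₄ := toReal_measure_Ioc_add P hXm hYm h₂₃.le h₃₄.le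
  have h₁₄ := toReal_measure_Ioc_add P hXm hYm h₁₂.le (h₂₃.trans h₃₄).le
  simp only [detS2, condProb, Matrix.cons_val]
  simp only [h₁₄, h₁₃, h₂₄]
  ring
end

section
/- Let v_{i,j} ∈ ℝ² for 1 ≤ i < j ≤ 4. Suppose: (1) for every 1 ≤ i < j < k ≤ 4 there exist a_{i,j,k} > 0, b_{i,j,k} > 0, c_{i,j,k} > 0 with a_{i,j,k} v_{i,j} − b_{i,j,k} v_{i,k} + c_{i,j,k} v_{j,k} = 0; (2) for every 1 ≤ i < j < k ≤ 4 the 2 × 3 matrix [v_{i,j}, v_{i,k}, v_{j,k}] has rank 2; (3) det^{S²}((v_{i,j})_{1≤i<j≤4}) = 0. Then there exist p₁, p₂, p₃, p₄ ∈ ℝ² and λ_{i,j} > 0 for 1 ≤ i < j ≤ 4 such that λ_{i,j} v_{i,j} = p_j − p_i for all 1 ≤ i < j ≤ 4. -/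
/-- The signed area of the parallelogram spanned by two plane vectors. -/
def planeCross (u w : ℝ × ℝ) : ℝ := u.1 * w.2 - u.2 * w.1

lemma planeCross_ne_zero_of_rank_eq_two {u w z : ℝ × ℝ} {a b c : ℝ}
    (hb : 0 < b) (hc : 0 < c) (h : a • u - b • w + c • z = 0)
    (hr : (Matrix.of ![![u.1, w.1, z.1], ![u.2, w.2, z.2]]).rank = 2) :
    planeCross u w ≠ 0 ∧ planeCross u z ≠ 0 := by
  have h₁ : a * u.1 - b * w.1 + c * z.1 = 0 := by simpa using congrArg Prod.fst h
  have h₂ : a * u.2 - b * w.2 + c * z.2 = 0 := by simpa using congrArg Prod.snd h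
  have hbc : b * planeCross u w = c * planeCross u z := by
    unfold planeCross; linear_combination u.2 * h₁ - u.1 * h₂
  have hab : b * planeCross w z = a * planeCross u z := by
    unfold planeCross; linear_combination z.1 * h₂ - z.2 * h₁
  have huz : planeCross u z ≠ 0 := by
    intro huz
    have huw : planeCross u w = 0 := by simpa [huz, hb.ne'] using hbc
    have hwz : planeCross w z = 0 := by simpa [huz, hb.ne'] using hab
    rw [Matrix.rank_eq_finrank_span_row] at hr
    have hli := LinearIndependent.pair_iff.mp
      (linearIndependent_iff_card_eq_finrank_span.mpr hr.symm :
        LinearIndependent ℝ ![![u.1, w.1, z.1], ![u.2, w.2, z.2]])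
    unfold planeCross at huz huw hwz
    have hu := hli u.2 (-u.1) (by ext i; fin_cases i <;> simp <;> linarith)
    have hw := hli w.2 (-w.1) (by ext i; fin_cases i <;> simp <;> linarith)
    have hz := hli z.2 (-z.1) (by ext i; fin_cases i <;> simp <;> linarith)
    have := hli 1 0 (by
      ext i; fin_cases i <;> simp
      exacts [neg_eq_zero.mp hu.2, neg_eq_zero.mp hw.2, neg_eq_zero.mp hz.2])
    exact one_ne_zero this.1
  refine ⟨fun huw => huz ?_, huz⟩
  simpa [huw, hc.ne'] using hbc

lemma detS2_smul {k : Type*} [Field k] (l : Fin 4 → Fin 4 → k) (v : Fin 4 → Fin 4 → k × k) :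
    detS2 (fun i j => l i j • v i j) =
      l 0 1 * l 0 2 * l 0 3 * l 1 2 * l 1 3 * l 2 3 * detS2 v := by
  simp only [detS2, Prod.smul_fst, Prod.smul_snd, smul_eq_mul]
  ring

/-- When the triangles `012` and `013` close up, `detS2` factors as a product of areas. -/
lemma detS2_eq_planeCross_mul (w : Fin 4 → Fin 4 → ℝ × ℝ)
    (h012 : w 0 2 = w 0 1 + w 1 2) (h013 : w 0 3 = w 0 1 + w 1 3) :
    detS2 w = planeCross (w 0 1) (w 1 2) * planeCross (w 0 1) (w 1 3) *
      planeCross (w 0 3 - w 0 2) (w 2 3) := by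
  simp only [detS2, planeCross, h012, h013, Prod.fst_add, Prod.snd_add, Prod.fst_sub, Prod.snd_sub]
  ring

/-- If each triple `v_{i,j}, v_{i,k}, v_{j,k}` satisfies a relation with positive
coefficients, each such triple spans a rank-`2` matrix, and `det^{S²}(v) = 0`, then there
are points `p_i ∈ ℝ²` and positive `λ_{i,j}` with `λ_{i,j} v_{i,j} = p_j - p_i`. -/
theorem exists_points_of_detS2_eq_zero (v : Fin 4 → Fin 4 → ℝ × ℝ)
    (h1 : ∀ i j k : Fin 4, i < j → j < k →
      ∃ a b c : ℝ, 0 < a ∧ 0 < b ∧ 0 < c ∧ a • v i j - b • v i k + c • v j k = 0)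
    (h2 : ∀ i j k : Fin 4, i < j → j < k →
      (Matrix.of ![![(v i j).1, (v i k).1, (v j k).1],
                   ![(v i j).2, (v i k).2, (v j k).2]]).rank = 2)
    (h3 : detS2 v = 0) :
    ∃ (p : Fin 4 → ℝ × ℝ) (l : Fin 4 → Fin 4 → ℝ),
      ∀ i j : Fin 4, i < j → 0 < l i j ∧ l i j • v i j = p j - p i := by
  obtain ⟨a, b, c, ha, hb, hc, e⟩ := h1 0 1 2 (by decide) (by decide)
  obtain ⟨a', b', c', ha', hb', hc', e'⟩ := h1 0 1 3 (by decide) (by decide)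
  obtain ⟨α, β, γ, hα, hβ, hγ, f⟩ := h1 0 2 3 (by decide) (by decide)
  have n012 := (planeCross_ne_zero_of_rank_eq_two hb hc e (h2 0 1 2 (by decide) (by decide))).2
  have n013 :=
    (planeCross_ne_zero_of_rank_eq_two hb' hc' e' (h2 0 1 3 (by decide) (by decide))).2
  have n023 := (planeCross_ne_zero_of_rank_eq_two hβ hγ f (h2 0 2 3 (by decide) (by decide))).1
  set r := a / a'
  have hr0 : 0 < r := div_pos ha ha'
  have hra : r * a' = a := div_mul_cancel₀ _ ha'.ne'
  have e02 : b • v 0 2 = a • v 0 1 + c • v 1 2 := by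
    linear_combination -e
  have e03 : (r * b') • v 0 3 = a • v 0 1 + (r * c') • v 1 3 := by
    rw [← hra]
    have := congrArg (r • ·) e'
    simp only [smul_zero] at this
    rw [← sub_eq_zero, ← neg_eq_zero, ← this]
    module
  have hD := detS2_smul ![![0, a, b, r * b'], ![0, 0, c, r * c'], ![0, 0, 0, 1], 0] v
  rw [h3, mul_zero, detS2_eq_planeCross_mul _ (by simpa using e02) (by simpa using e03)] at hD
  have hcross : planeCross ((r * b') • v 0 3 - b • v 0 2) (v 2 3) = 0 := by
    have hx : planeCross (a • v 0 1) (c • v 1 2) = a * c * planeCross (v 0 1) (v 1 2) := by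
      simp [planeCross]; ring
    have hy : planeCross (a • v 0 1) ((r * c') • v 1 3) =
        a * (r * c') * planeCross (v 0 1) (v 1 3) := by
      simp [planeCross]; ring
    simpa [hx, hy, ha.ne', hc.ne', hr0.ne', hc'.ne', n012, n013] using hD
  have f₁ : α * (v 0 2).1 - β * (v 0 3).1 + γ * (v 2 3).1 = 0 := by
    simpa using congrArg Prod.fst f
  have f₂ : α * (v 0 2).2 - β * (v 0 3).2 + γ * (v 2 3).2 = 0 := by
    simpa using congrArg Prod.snd f
  have hprop : b * β = r * b' * α := by
    apply mul_right_cancel₀ n023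
    simp only [planeCross, Prod.fst_sub, Prod.snd_sub, Prod.smul_fst, Prod.smul_snd,
      smul_eq_mul] at hcross ⊢
    linear_combination (-γ) * hcross +
      (r * b' * (v 0 3).1 - b * (v 0 2).1) * f₂ - (r * b' * (v 0 3).2 - b * (v 0 2).2) * f₁
  have e23 : (b * γ / α) • v 2 3 = (r * b') • v 0 3 - b • v 0 2 := by
    ext <;> simp <;> field_simp
    · linear_combination b * f₁ + (v 0 3).1 * hprop
    · linear_combination b * f₂ + (v 0 3).2 * hprop
  refine ⟨![0, a • v 0 1, b • v 0 2, (r * b') • v 0 3],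
    ![![0, a, b, r * b'], ![0, 0, c, r * c'], ![0, 0, 0, b * γ / α], 0], ?_⟩
  intro i j hij
  fin_cases i <;> fin_cases j <;> first | exact absurd hij (by decide) | skip
  · simpa using ha
  · simpa using hb
  · simpa using mul_pos hr0 hb'
  · exact ⟨hc, by simp [e02]⟩
  · exact ⟨mul_pos hr0 hc', by simp [e03]⟩
  · exact ⟨by simp; positivity, by simpa using e23⟩
end

section
/- Let s ≥ 4, d ≥ 2, and let v_{i,j} ∈ ℝ^d with coordinates v_{i,j}^1, …, v_{i,j}^d for 1 ≤ i < j ≤ s. Suppose: (1) for every 1 ≤ i < j < k ≤ s there exist a_{i,j,k} > 0, b_{i,j,k} > 0, c_{i,j,k} > 0 with a_{i,j,k} v_{i,j} − b_{i,j,k} v_{i,k} + c_{i,j,k} v_{j,k} = 0; (2) for every 1 ≤ i < j < k < l ≤ s and every 1 ≤ a ≤ d there exists b (depending on a, i, j, k, l) such that for all i₁ < i₂ < i₃ in {i, j, k, l} the 2 × 3 matrix with rows (v_{i₁,i₂}^a, v_{i₁,i₃}^a, v_{i₂,i₃}^a) and (v_{i₁,i₂}^b, v_{i₁,i₃}^b,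 v_{i₂,i₃}^b) has rank 2; (3) (v_{i,j})_{1≤i<j≤s} has S²-rank equal to 1. Then there exist p_i ∈ ℝ^d for 1 ≤ i ≤ s and λ_{i,j} > 0 for 1 ≤ i < j ≤ s such that λ_{i,j} v_{i,j} = p_j − p_i for all 1 ≤ i < j ≤ s. -/
/-- A family `(v_{i,j})_{1 ≤ i < j ≤ s}` of vectors in `ℝ^d` (with `v i j a` the `a`-th
coordinate of `v_{i,j}`, `1 ≤ a ≤ d`) has `S²`-rank equal to `1` if every `2`-minor has
vanishing `det^{S²}`. -/
def S2RankOne (s d : ℕ) (v : ℕ → ℕ → ℕ → ℝ) : Prop :=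
  ∀ x₁ x₂ x₃ x₄ : ℕ, 1 ≤ x₁ → x₁ < x₂ → x₂ < x₃ → x₃ < x₄ → x₄ ≤ s →
  ∀ a₁ a₂ : ℕ, 1 ≤ a₁ → a₁ < a₂ → a₂ ≤ d →
    detS2 (fun p q : Fin 4 =>
      (v (![x₁, x₂, x₃, x₄] p) (![x₁, x₂, x₃, x₄] q) a₁,
       v (![x₁, x₂, x₃, x₄] p) (![x₁, x₂, x₃, x₄] q) a₂)) = 0

/-- A `2 × 3` matrix of rank `2` has a nonzero `2`-minor. -/
lemma exists_minor_ne_zero_of_rank_eq_two {k : Type*} [Field k] {x y z x' y' z' : k}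
    (h : (Matrix.of ![![x, y, z], ![x', y', z']]).rank = 2) :
    x * y' - x' * y ≠ 0 ∨ x * z' - x' * z ≠ 0 ∨ y * z' - y' * z ≠ 0 := by
  by_contra! H
  obtain ⟨hxy, hxz, hyz⟩ := H
  have hli : LinearIndependent k ![![x, y, z], ![x', y', z']] := by
    rw [linearIndependent_iff_card_eq_finrank_span]
    rw [Matrix.rank_eq_finrank_span_row] at h
    exact h.symm
  rw [LinearIndependent.pair_iff] at hli
  have hx := hli x' (-x) (by ext i; fin_cases i <;> simp <;> grind)
  have hy := hli y' (-y) (by ext i; fin_cases i <;> simp <;> grind)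
  have hz := hli z' (-z) (by ext i; fin_cases i <;> simp <;> grind)
  have h0 := hli 1 0 (by
    ext i
    fin_cases i <;> simp [neg_eq_zero.mp hx.2, neg_eq_zero.mp hy.2, neg_eq_zero.mp hz.2])
  exact one_ne_zero h0.1

/-- If three plane vectors spanning the plane satisfy a linear relation with nonzero
coefficients, then the first two of them are linearly independent. -/
lemma minor_ne_zero_of_relation {k : Type*} [Field k] {x y z x' y' z' a b c : k}
    (h : (Matrix.of ![![x, y, z], ![x', y', z']]).rank = 2) (hc : c ≠ 0)
    (e : a * x - b * y + c * z = 0) (e' : a * x' - b * y' + c * z' = 0) :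
    x * y' - x' * y ≠ 0 := by
  intro hxy
  rcases exists_minor_ne_zero_of_rank_eq_two h with H | H | H
  · exact H hxy
  · refine H (mul_left_cancel₀ hc ?_)
    linear_combination x * e' - x' * e + b * hxy
  · refine H (mul_left_cancel₀ hc ?_)
    linear_combination y * e' - y' * e + a * hxy

/-- If the relations on the three triangles through the first vertex are given, `det^{S²}`
factors as a product of three minors and the obstruction to gluing the relations. -/
lemma detS2_mul_of_relations {k : Type*} [Field k] (w : Fin 4 → Fin 4 → k × k)
    {a₁ b₁ c₁ a₂ b₂ c₂ a₃ b₃ c₃ : k}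
    (h₁ : a₁ • w 0 1 - b₁ • w 0 2 + c₁ • w 1 2 = 0)
    (h₂ : a₂ • w 0 1 - b₂ • w 0 3 + c₂ • w 1 3 = 0)
    (h₃ : a₃ • w 0 2 - b₃ • w 0 3 + c₃ • w 2 3 = 0) :
    c₁ * c₂ * c₃ * detS2 w =
      (a₁ * b₂ * a₃ - b₁ * a₂ * b₃) *
        ((w 0 1).1 * (w 0 2).2 - (w 0 1).2 * (w 0 2).1) *
        ((w 0 1).1 * (w 0 3).2 - (w 0 1).2 * (w 0 3).1) *
        ((w 0 2).1 * (w 0 3).2 - (w 0 2).2 * (w 0 3).1) := by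
  simp only [Prod.ext_iff, Prod.fst_add, Prod.fst_sub, Prod.smul_fst, Prod.snd_add,
    Prod.snd_sub, Prod.smul_snd, smul_eq_mul, Prod.fst_zero, Prod.snd_zero] at h₁ h₂ h₃
  unfold detS2
  generalize w 0 1 = p, w 0 2 = q, w 0 3 = r, w 1 2 = x, w 1 3 = y, w 2 3 = z at *
  obtain ⟨p, p'⟩ := p
  obtain ⟨q, q'⟩ := q
  obtain ⟨r, r'⟩ := r
  obtain ⟨x, x'⟩ := x
  obtain ⟨y, y'⟩ := y
  obtain ⟨z, z'⟩ := z
  simp only at *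
  have e₁ : c₁ * x = b₁ * q - a₁ * p := by linear_combination h₁.1
  have e₁' : c₁ * x' = b₁ * q' - a₁ * p' := by linear_combination h₁.2
  have e₂ : c₂ * y = b₂ * r - a₂ * p := by linear_combination h₂.1
  have e₂' : c₂ * y' = b₂ * r' - a₂ * p' := by linear_combination h₂.2
  have e₃ : c₃ * z = b₃ * r - a₃ * q := by linear_combination h₃.1
  have e₃' : c₃ * z' = b₃ * r' - a₃ * q' := by linear_combination h₃.2
  trans p * (c₁ * x) * (c₃ * z) * q' * (c₂ * y') * r'
    + p * (c₁ * x') * (c₃ * z) * q' * (c₂ * y') * r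
    + p * (c₁ * x') * (c₃ * z') * q * (c₂ * y) * r'
    + p' * (c₁ * x') * (c₃ * z) * q * (c₂ * y) * r'
    + p' * (c₁ * x) * (c₃ * z') * q' * (c₂ * y) * r
    + p' * (c₁ * x) * (c₃ * z') * q * (c₂ * y') * r
    - p' * (c₁ * x') * (c₃ * z') * q * (c₂ * y) * r
    - p' * (c₁ * x) * (c₃ * z') * q * (c₂ * y) * r'
    - p' * (c₁ * x) * (c₃ * z) * q' * (c₂ * y') * r
    - p * (c₁ * x) * (c₃ * z') * q' * (c₂ * y') * r
    - p * (c₁ * x') * (c₃ * z) * q * (c₂ * y') * r'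
    - p * (c₁ * x') * (c₃ * z) * q' * (c₂ * y) * r'
  · ring
  · rw [e₁, e₁', e₂, e₂', e₃, e₃']
    ring

/-- Lemma: under positivity, rank and `S²`-rank hypotheses, there are `p_i ∈ ℝ^d` and
`λ_{i,j} > 0` with `λ_{i,j} v_{i,j} = p_j - p_i` for all `1 ≤ i < j ≤ s`. -/
theorem exists_points_of_S2_rank_one (s d : ℕ) (hs : 4 ≤ s) (hd : 2 ≤ d)
    (v : ℕ → ℕ → ℕ → ℝ)
    (h1 : ∀ i j k : ℕ, 1 ≤ i → i < j → j < k → k ≤ s →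
      ∃ a b c : ℝ, 0 < a ∧ 0 < b ∧ 0 < c ∧
        ∀ x : ℕ, 1 ≤ x → x ≤ d → a * v i j x - b * v i k x + c * v j k x = 0)
    (h2 : ∀ i j k l : ℕ, 1 ≤ i → i < j → j < k → k < l → l ≤ s →
      ∀ a : ℕ, 1 ≤ a → a ≤ d → ∃ b : ℕ, 1 ≤ b ∧ b ≤ d ∧
        ∀ i₁ i₂ i₃ : ℕ, i₁ < i₂ → i₂ < i₃ →
          i₁ ∈ ({i, j, k, l} : Set ℕ) → i₂ ∈ ({i, j, k, l} : Set ℕ) →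
          i₃ ∈ ({i, j, k, l} : Set ℕ) →
          (Matrix.of ![![v i₁ i₂ a, v i₁ i₃ a, v i₂ i₃ a],
                       ![v i₁ i₂ b, v i₁ i₃ b, v i₂ i₃ b]]).rank = 2)
    (h3 : S2RankOne s d v) :
    ∃ (p : ℕ → ℕ → ℝ) (l : ℕ → ℕ → ℝ),
      ∀ i j : ℕ, 1 ≤ i → i < j → j ≤ s → 0 < l i j ∧
        ∀ a : ℕ, 1 ≤ a → a ≤ d → l i j * v i j a = p j a - p i a := by
  choose! a b c ha hb hc habc using h1
  have key : ∀ j k : ℕ, 2 < j → j < k → k ≤ s →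
      b 1 2 j * a 1 2 k * b 1 j k = a 1 2 j * b 1 2 k * a 1 j k := by
    intro j k hj hjk hk
    obtain ⟨y, hy1, hyd, hrank⟩ := h2 1 2 j k le_rfl one_lt_two hj hjk hk 1 le_rfl (by omega)
    have hminor : ∀ m n : ℕ, m ∈ ({1, 2, j, k} : Set ℕ) → n ∈ ({1, 2, j, k} : Set ℕ) →
        1 < m → m < n → n ≤ s →
        v 1 m 1 * v 1 n y - v 1 m y * v 1 n 1 ≠ 0 := fun m n hm hn h1m hmn hns =>
      minor_ne_zero_of_relation (hrank 1 m n h1m hmn (by simp) hm hn)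
        (hc 1 m n le_rfl h1m hmn hns).ne'
        (habc 1 m n le_rfl h1m hmn hns 1 le_rfl (by omega))
        (habc 1 m n le_rfl h1m hmn hns y hy1 hyd)
    have m₁ := hminor 2 j (by simp) (by simp) one_lt_two hj (by omega)
    have m₂ := hminor 2 k (by simp) (by simp) one_lt_two (by omega) hk
    have m₃ := hminor j k (by simp) (by simp) (by omega) hjk hk
    have hy : 1 < y := by
      refine lt_of_le_of_ne hy1 ?_
      rintro rfl
      exact m₁ (by ring)
    have hrel : ∀ m n : ℕ, 1 < m → m < n → n ≤ s →
        a 1 m n • (v 1 m 1, v 1 m y) - b 1 m n • (v 1 n 1, v 1 n y) +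
          c 1 m n • (v m n 1, v m n y) = 0 := fun m n h1m hmn hns =>
      Prod.ext (habc 1 m n le_rfl h1m hmn hns 1 le_rfl (by omega))
        (habc 1 m n le_rfl h1m hmn hns y hy1 hyd)
    have hdet := detS2_mul_of_relations
      (fun p q : Fin 4 => (v (![1, 2, j, k] p) (![1, 2, j, k] q) 1,
        v (![1, 2, j, k] p) (![1, 2, j, k] q) y))
      (hrel 2 j one_lt_two hj (by omega)) (hrel 2 k one_lt_two (by omega) hk)
      (hrel j k (by omega) hjk hk)
    rw [h3 1 2 j k le_rfl one_lt_two hj hjk hk 1 y le_rfl hy hyd, mul_zero, eq_comm,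
      mul_eq_zero, mul_eq_zero, mul_eq_zero] at hdet
    rcases hdet with ((h | h) | h) | h
    · exact (sub_eq_zero.mp h).symm
    · exact absurd h m₁
    · exact absurd h m₂
    · exact absurd h m₃
  refine ⟨fun j x => if j = 1 then 0 else if j = 2 then v 1 2 x else
      b 1 2 j / a 1 2 j * v 1 j x,
    fun i j => if i = 1 then (if j = 2 then 1 else b 1 2 j / a 1 2 j) else
      if i = 2 then c 1 2 j / a 1 2 j else
      b 1 2 j * c 1 i j / (a 1 2 j * b 1 i j), fun i j hi hij hj => ?_⟩
  have hj1 : j ≠ 1 := by omega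
  rcases (by omega : i = 1 ∧ j = 2 ∨ i = 1 ∧ 2 < j ∨ i = 2 ∨ 2 < i) with
    ⟨rfl, rfl⟩ | ⟨rfl, hj2⟩ | rfl | hi2
  · simp
  · have := ha 1 2 j le_rfl one_lt_two hj2 hj
    have := hb 1 2 j le_rfl one_lt_two hj2 hj
    simp only [if_true, if_neg hj1, if_neg hj2.ne', sub_zero]
    exact ⟨by positivity, fun _ _ _ => trivial⟩
  · have ha' := ha 1 2 j le_rfl one_lt_two hij hj
    have := hc 1 2 j le_rfl one_lt_two hij hj
    simp only [if_true, if_neg hj1, if_neg hij.ne', if_neg (by decide : ¬(2 = 1))]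
    refine ⟨by positivity, fun x hx hxd => ?_⟩
    field_simp
    linear_combination habc 1 2 j le_rfl one_lt_two hij hj x hx hxd
  · have hj2 : 2 < j := hi2.trans hij
    have hi1 : 1 < i := by omega
    have hai := ha 1 2 i le_rfl one_lt_two hi2 (by omega)
    have haj := ha 1 2 j le_rfl one_lt_two hj2 hj
    have hbj := hb 1 2 j le_rfl one_lt_two hj2 hj
    have hbij := hb 1 i j le_rfl hi1 hij hj
    have hcij := hc 1 i j le_rfl hi1 hij hj
    simp only [if_neg hj1, if_neg hj2.ne', if_neg hi1.ne', if_neg hi2.ne']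
    refine ⟨by positivity, fun x hx hxd => ?_⟩
    have hrel := habc 1 i j le_rfl hi1 hij hj x hx hxd
    field_simp
    linear_combination a 1 2 i * b 1 2 j * hrel + v 1 i x * key i j hi2 hij hj
end

section
/- Let s ≥ 4, d ≥ 2, and let v_{i,j} ∈ ℝ^d with coordinates v_{i,j}^1, …, v_{i,j}^d for 1 ≤ i < j ≤ s. Assume: (1) v_{i,j}^a ∈ [0,1] for all a, and ∑_{a=1}^{d} v_{i,j}^a = 1 for all 1 ≤ i < j ≤ s; (2) for every 1 ≤ i < j < k ≤ s there exist a_{i,j,k} > 0, b_{i,j,k} > 0, c_{i,j,k} > 0 with a_{i,j,k} v_{i,j} − b_{i,j,k} v_{i,k} + c_{i,j,k} v_{j,k} = 0; (3) for every 1 ≤ i < j < k < l ≤ s and every 1 ≤ a ≤ d there exists b such that for all i₁ < i₂ < i₃ in {i, j, k, l} the 2 × 3 matrix with rows (v_{i₁,i₂}^a, v_{i₁,i₃}^a, v_{i₂,i₃}^a) and (v_{i₁,i₂}^b, v_{i₁,i₃}^b, v_{i₂,i₃}^b) has rank 2; (4) (v_{i,j})_{1≤i<j≤s} has S²-rank equal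 to 1. Then there exist measurable random variables X : (0,1] → {1,…,s} and Y : (0,1] → {1,…,d}, where (0,1] carries the Lebesgue probability measure P, such that P(i < X ≤ j) > 0 and v_{i,j}^a = P(Y = a | i < X ≤ j) for all 1 ≤ i < j ≤ s and all 1 ≤ a ≤ d. -/
open MeasureTheory

/-- The bracket form of `detS2`: its vanishing says that the ratios of the triangle relations
around the first vertex are compatible. -/
theorem detS2_eq_brackets {k : Type*} [Field k] (v : Fin 4 → Fin 4 → k × k) :
    detS2 v =
      ((v 0 2).1 * (v 1 2).2 - (v 0 2).2 * (v 1 2).1) *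
        ((v 0 3).1 * (v 2 3).2 - (v 0 3).2 * (v 2 3).1) *
        ((v 0 1).1 * (v 1 3).2 - (v 0 1).2 * (v 1 3).1) -
      ((v 0 1).1 * (v 1 2).2 - (v 0 1).2 * (v 1 2).1) *
        ((v 0 2).1 * (v 2 3).2 - (v 0 2).2 * (v 2 3).1) *
        ((v 0 3).1 * (v 1 3).2 - (v 0 3).2 * (v 1 3).1) := by
  unfold detS2
  ring

/-- The vanishing of the `2`-minors of an `S²`-rank one family, in bracket form and without
an order on the two coordinates. -/
theorem S2RankOne.brackets_eq {s d : ℕ} {v : ℕ → ℕ → ℕ → ℝ} (h : S2RankOne s d v)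
    {i j k l : ℕ} (hi : 1 ≤ i) (hij : i < j) (hjk : j < k) (hkl : k < l) (hl : l ≤ s)
    {a b : ℕ} (ha : 1 ≤ a) (had : a ≤ d) (hb : 1 ≤ b) (hbd : b ≤ d) :
    (v i j a * v j k b - v i j b * v j k a) * (v i k a * v k l b - v i k b * v k l a) *
        (v i l a * v j l b - v i l b * v j l a) =
      (v i k a * v j k b - v i k b * v j k a) * (v i l a * v k l b - v i l b * v k l a) *
        (v i j a * v j l b - v i j b * v j l a) := by
  rcases lt_trichotomy a b with hab | rfl | hab
  · have := h i j k l hi hij hjk hkl hl a b ha hab hbd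
    rw [detS2_eq_brackets] at this
    simp at this
    linear_combination -this
  · ring
  · have := h i j k l hi hij hjk hkl hl b a hb hab had
    rw [detS2_eq_brackets] at this
    simp at this
    linear_combination this

/-- If the columns of a `2 × 3` matrix of rank `2` satisfy a relation with nonzero first
coefficient, then its last two columns are linearly independent. -/
theorem det_last_columns_ne_zero_of_rank_eq_two {u₁ u₂ u₃ w₁ w₂ w₃ p q r : ℝ} (hp : p ≠ 0)
    (hrank : (Matrix.of ![![u₁, u₂, u₃], ![w₁, w₂, w₃]]).rank = 2)
    (hu : p * u₁ - q * u₂ + r * u₃ = 0) (hw : p * w₁ - q * w₂ + r * w₃ = 0) :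
    u₂ * w₃ - w₂ * u₃ ≠ 0 := by
  intro h₂₃
  have h₁₃ : u₁ * w₃ - w₁ * u₃ = 0 :=
    mul_left_cancel₀ hp (by linear_combination w₃ * hu - u₃ * hw + q * h₂₃)
  have h₁₂ : u₁ * w₂ - w₁ * u₂ = 0 :=
    mul_left_cancel₀ hp (by linear_combination w₂ * hu - u₂ * hw + r * h₂₃)
  set A := Matrix.of ![![u₁, u₂, u₃], ![w₁, w₂, w₃]] with hA
  have hli : LinearIndependent ℝ A.row := by
    rw [linearIndependent_iff_card_eq_finrank_span, Set.finrank,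
      ← Matrix.rank_eq_finrank_span_row, hrank, Fintype.card_fin]
  rw [Fintype.linearIndependent_iff] at hli
  have key : ∀ x y : ℝ, x * u₁ + y * w₁ = 0 → x * u₂ + y * w₂ = 0 → x * u₃ + y * w₃ = 0 →
      x = 0 ∧ y = 0 := by
    intro x y e₁ e₂ e₃
    have := hli ![x, y] (by
      ext n
      fin_cases n <;> simpa [hA, Fin.sum_univ_two, Matrix.row])
    exact ⟨this 0, this 1⟩
  have k₁ := key w₁ (-u₁) (by ring) (by linear_combination -h₁₂) (by linear_combination -h₁₃)
  have k₂ := key w₂ (-u₂) (by linear_combination h₁₂) (by ring) (by linear_combination -h₂₃)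
  have k₃ := key w₃ (-u₃) (by linear_combination h₁₃) (by linear_combination h₂₃) (by ring)
  have := key 1 0 (by linear_combination -k₁.2) (by linear_combination -k₂.2)
    (by linear_combination -k₃.2)
  exact one_ne_zero this.1

/-- A family satisfying the hypotheses of the main theorem is given by the slopes
`(F j - F i) / (W j - W i)` of a vector-valued function `F` along a strictly increasing
function `W`. -/
theorem exists_cumulative_of_S2_rank_one {s d : ℕ}
    {v : ℕ → ℕ → ℕ → ℝ} (hd : 1 ≤ d)
    (hsum : ∀ i j : ℕ, 1 ≤ i → i < j → j ≤ s → (∑ a ∈ Finset.Icc 1 d, v i j a) = 1)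
    (h1 : ∀ i j k : ℕ, 1 ≤ i → i < j → j < k → k ≤ s →
      ∃ a b c : ℝ, 0 < a ∧ 0 < b ∧ 0 < c ∧
        ∀ x : ℕ, 1 ≤ x → x ≤ d → a * v i j x - b * v i k x + c * v j k x = 0)
    (h2 : ∀ i j k l : ℕ, 1 ≤ i → i < j → j < k → k < l → l ≤ s →
      ∀ a : ℕ, 1 ≤ a → a ≤ d → ∃ b : ℕ, 1 ≤ b ∧ b ≤ d ∧
        ∀ i₁ i₂ i₃ : ℕ, i₁ < i₂ → i₂ < i₃ →
          i₁ ∈ ({i, j, k, l} : Set ℕ) → i₂ ∈ ({i, j, k, l} : Set ℕ) →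
          i₃ ∈ ({i, j, k, l} : Set ℕ) →
          (Matrix.of ![![v i₁ i₂ a, v i₁ i₃ a, v i₂ i₃ a],
                       ![v i₁ i₂ b, v i₁ i₃ b, v i₂ i₃ b]]).rank = 2)
    (h3 : S2RankOne s d v) :
    ∃ (W : ℕ → ℝ) (F : ℕ → ℕ → ℝ), ∀ i j : ℕ, 1 ≤ i → i < j → j ≤ s →
      W i < W j ∧ ∀ a : ℕ, 1 ≤ a → a ≤ d → F j a - F i a = (W j - W i) * v i j a := by
  have normalized : ∀ i j k : ℕ, 1 ≤ i → i < j → j < k → k ≤ s → ∃ w : ℝ, 1 < w ∧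
      ∀ x : ℕ, 1 ≤ x → x ≤ d → 1 * v i j x - w * v i k x + (w - 1) * v j k x = 0 := by
    intro i j k hi hij hjk hk
    obtain ⟨a, b, c, ha, hb, hc, h⟩ := h1 i j k hi hij hjk hk
    have hb' : b = a + c := by
      have e : ∑ x ∈ Finset.Icc 1 d, (a * v i j x - b * v i k x + c * v j k x) = 0 :=
        Finset.sum_eq_zero fun x hx => h x (Finset.mem_Icc.1 hx).1 (Finset.mem_Icc.1 hx).2
      rw [Finset.sum_add_distrib, Finset.sum_sub_distrib, ← Finset.mul_sum, ← Finset.mul_sum,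
        ← Finset.mul_sum, hsum i j hi hij (by omega), hsum i k hi (by omega) hk,
        hsum j k (by omega) hjk hk] at e
      linarith
    refine ⟨b / a, by rw [lt_div_iff₀ ha]; linarith, fun x hx hxd => ?_⟩
    have := h x hx hxd
    subst hb'
    field_simp
    linear_combination this
  choose! w hw hrel using fun k (hk : 2 < k ∧ k ≤ s) => normalized 1 2 k le_rfl one_lt_two hk.1 hk.2
  set W : ℕ → ℝ := fun j => if j ≤ 1 then 0 else if j = 2 then 1 else w j with hW
  have W1 : W 1 = 0 := by simp [hW]
  have W2 : W 2 = 1 := by simp [hW]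
  have W3 : ∀ j, 2 < j → W j = w j := fun j hj => by
    simp [hW, show ¬ j ≤ 1 by omega, show j ≠ 2 by omega]
  refine ⟨W, fun j a => W j * v 1 j a, fun i j hi hij hj => ?_⟩
  obtain rfl | rfl | hi2 : i = 1 ∨ i = 2 ∨ 2 < i := by omega
  · simp only [W1]
    refine ⟨?_, fun a _ _ => by ring⟩
    rcases (show j = 2 ∨ 2 < j by omega) with rfl | hj2
    · simp [W2]
    · rw [W3 j hj2]
      linarith [hw j ⟨hj2, hj⟩]
  · simp only [W2, W3 j hij]
    exact ⟨hw j ⟨hij, hj⟩, fun a ha had => by linear_combination -hrel j ⟨hij, hj⟩ a ha had⟩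
  simp only [W3 i hi2, W3 j (hi2.trans hij)]
  have hiw := hw i ⟨hi2, by omega⟩
  have hjw := hw j ⟨by omega, hj⟩
  obtain ⟨μ, hμ, hμrel⟩ := normalized 1 i j le_rfl (by omega) hij hj
  have hirel := hrel i ⟨hi2, by omega⟩
  have hjrel := hrel j ⟨by omega, hj⟩
  obtain ⟨b, hb, hbd, hrank⟩ := h2 1 2 i j le_rfl one_lt_two hi2 hij hj 1 le_rfl hd
  have n₁ := det_last_columns_ne_zero_of_rank_eq_two one_ne_zero
    (hrank 1 2 i one_lt_two hi2 (by simp) (by simp) (by simp))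
    (hirel 1 le_rfl hd) (hirel b hb hbd)
  have n₂ := det_last_columns_ne_zero_of_rank_eq_two one_ne_zero
    (hrank 1 2 j one_lt_two (by omega) (by simp) (by simp) (by simp))
    (hjrel 1 le_rfl hd) (hjrel b hb hbd)
  have n₃ := det_last_columns_ne_zero_of_rank_eq_two one_ne_zero
    (hrank 1 i j (by omega) hij (by simp) (by simp) (by simp))
    (hμrel 1 le_rfl hd) (hμrel b hb hbd)
  have e₁ : v 1 2 1 * v 2 i b - v 1 2 b * v 2 i 1 =
      w i * (v 1 i 1 * v 2 i b - v 1 i b * v 2 i 1) := by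
    linear_combination v 2 i b * hirel 1 le_rfl hd - v 2 i 1 * hirel b hb hbd
  have e₂ : v 1 2 1 * v 2 j b - v 1 2 b * v 2 j 1 =
      w j * (v 1 j 1 * v 2 j b - v 1 j b * v 2 j 1) := by
    linear_combination v 2 j b * hjrel 1 le_rfl hd - v 2 j 1 * hjrel b hb hbd
  have e₃ : v 1 i 1 * v i j b - v 1 i b * v i j 1 =
      μ * (v 1 j 1 * v i j b - v 1 j b * v i j 1) := by
    linear_combination v i j b * hμrel 1 le_rfl hd - v i j 1 * hμrel b hb hbd
  have hdet := h3.brackets_eq le_rfl one_lt_two hi2 hij hj le_rfl hd hb hbd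
  rw [e₁, e₂, e₃] at hdet
  have hwμ : w j = w i * μ := by
    refine mul_left_cancel₀ (mul_ne_zero (mul_ne_zero n₁ n₂) n₃) ?_
    linear_combination -hdet
  rw [hwμ]
  refine ⟨by nlinarith, fun a ha had => ?_⟩
  linear_combination -w i * hμrel a ha had

/-- Any probability weights on a finite set of pairs of natural numbers are realized by a
measurable function on `(0,1]` with Lebesgue measure. -/
theorem exists_measurable_of_weights (S : Finset (ℕ × ℕ)) (p : ℕ × ℕ → ℝ)
    (hp : ∀ x ∈ S, 0 ≤ p x) (hsum : ∑ x ∈ S, p x = 1) :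
    ∃ Z : ℝ → ℕ × ℕ, Measurable Z ∧ (∀ t, Z t ∈ S) ∧
      ∀ T : Finset (ℕ × ℕ), T ⊆ S →
        (volume.restrict (Set.Ioc (0 : ℝ) 1)) (Z ⁻¹' T) = ENNReal.ofReal (∑ x ∈ T, p x) := by
  have htot : ∑ x : S, ENNReal.ofReal (p x) = 1 := by
    rw [Finset.sum_coe_sort S fun x => ENNReal.ofReal (p x),
      ← ENNReal.ofReal_sum_of_nonneg hp, hsum, ENNReal.ofReal_one]
  set P : PMF S := PMF.ofFintype (fun x => ENNReal.ofReal (p x)) htot with hP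
  have : Nonempty S := by
    by_contra h
    rw [not_nonempty_iff] at h
    simp at htot
  obtain ⟨f, hf, hfP⟩ := P.toMeasure.exists_measurable_map_eq
  set g : ℝ → S := fun t => f (Set.projIcc 0 1 zero_le_one t) with hg
  have hgm : Measurable g := hf.comp (continuous_projIcc.measurable)
  have hgP : (volume.restrict (Set.Ioc (0 : ℝ) 1)).map g = P.toMeasure := by
    rw [Measure.restrict_congr_set Ioc_ae_eq_Icc,
      ← (measurePreserving_subtype_coe (μa := volume)
        (measurableSet_Icc (a := (0 : ℝ)) (b := 1))).map_eq,
      Measure.map_map hgm measurable_subtype_coe, ← hfP]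
    congr 1
    funext t
    simp [hg]
  refine ⟨fun t => g t, measurable_subtype_coe.comp hgm, fun t => (g t).2, fun T hT => ?_⟩
  have hpre : (fun t => (g t : ℕ × ℕ)) ⁻¹' T = g ⁻¹' {x | (x : ℕ × ℕ) ∈ T} := rfl
  rw [hpre, ← Measure.map_apply hgm (MeasurableSet.of_discrete), hgP,
    PMF.toMeasure_apply_fintype, ENNReal.ofReal_sum_of_nonneg fun x hx => hp x (hT hx)]
  simp only [Set.indicator_apply, Set.mem_ofPred_eq, hP, PMF.ofFintype_apply]
  rw [Finset.sum_coe_sort S fun x => if x ∈ T then ENNReal.ofReal (p x) else 0,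
    ← Finset.sum_filter, Finset.filter_mem_eq_inter, Finset.inter_eq_right.2 hT]

/-- Converse theorem: a family satisfying the stochastic, positivity, rank and `S²`-rank
conditions is the conditional probability matrix of random variables
`X : (0,1] → {1,…,s}`, `Y : (0,1] → {1,…,d}` with respect to Lebesgue measure. -/
theorem exists_random_variables_of_S2_rank_one (s d : ℕ) (hs : 4 ≤ s) (hd : 2 ≤ d)
    (v : ℕ → ℕ → ℕ → ℝ)
    (h0 : ∀ i j : ℕ, 1 ≤ i → i < j → j ≤ s →
      (∀ a : ℕ, 1 ≤ a → a ≤ d → v i j a ∈ Set.Icc (0 : ℝ) 1) ∧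
      (∑ a ∈ Finset.Icc 1 d, v i j a) = 1)
    (h1 : ∀ i j k : ℕ, 1 ≤ i → i < j → j < k → k ≤ s →
      ∃ a b c : ℝ, 0 < a ∧ 0 < b ∧ 0 < c ∧
        ∀ x : ℕ, 1 ≤ x → x ≤ d → a * v i j x - b * v i k x + c * v j k x = 0)
    (h2 : ∀ i j k l : ℕ, 1 ≤ i → i < j → j < k → k < l → l ≤ s →
      ∀ a : ℕ, 1 ≤ a → a ≤ d → ∃ b : ℕ, 1 ≤ b ∧ b ≤ d ∧
        ∀ i₁ i₂ i₃ : ℕ, i₁ < i₂ → i₂ < i₃ →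
          i₁ ∈ ({i, j, k, l} : Set ℕ) → i₂ ∈ ({i, j, k, l} : Set ℕ) →
          i₃ ∈ ({i, j, k, l} : Set ℕ) →
          (Matrix.of ![![v i₁ i₂ a, v i₁ i₃ a, v i₂ i₃ a],
                       ![v i₁ i₂ b, v i₁ i₃ b, v i₂ i₃ b]]).rank = 2)
    (h3 : S2RankOne s d v) :
    ∃ X Y : ℝ → ℕ, Measurable X ∧ Measurable Y ∧
      (∀ t ∈ Set.Ioc (0 : ℝ) 1, 1 ≤ X t ∧ X t ≤ s) ∧
      (∀ t ∈ Set.Ioc (0 : ℝ) 1, 1 ≤ Y t ∧ Y t ≤ d) ∧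
      ∀ i j : ℕ, 1 ≤ i → i < j → j ≤ s →
        0 < (volume.restrict (Set.Ioc (0 : ℝ) 1)) {t | i < X t ∧ X t ≤ j} ∧
        ∀ a : ℕ, 1 ≤ a → a ≤ d →
          v i j a =
            ((volume.restrict (Set.Ioc (0 : ℝ) 1)) {t | Y t = a ∧ i < X t ∧ X t ≤ j}).toReal /
              ((volume.restrict (Set.Ioc (0 : ℝ) 1)) {t | i < X t ∧ X t ≤ j}).toReal := by
  obtain ⟨W, F, hWF⟩ := exists_cumulative_of_S2_rank_one (by omega)
    (fun i j hi hij hj => (h0 i j hi hij hj).2) h1 h2 h3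
  have hL : 0 < W s - W 1 := sub_pos.2 (hWF 1 s le_rfl (by omega) le_rfl).1
  set p : ℕ × ℕ → ℝ := fun x => (F (x.1 + 1) x.2 - F x.1 x.2) / (W s - W 1) with hp
  have hcol : ∀ i j : ℕ, 1 ≤ i → i < j → j ≤ s → ∀ a : ℕ, 1 ≤ a → a ≤ d →
      ∑ m ∈ Finset.Ico i j, p (m, a) = (W j - W i) * v i j a / (W s - W 1) := by
    intro i j hi hij hj a ha had
    simp only [hp]
    rw [← Finset.sum_div, Finset.sum_Ico_sub (fun m => F m a) hij.le, (hWF i j hi hij hj).2 a ha had]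
  have hblock : ∀ i j : ℕ, 1 ≤ i → i < j → j ≤ s →
      ∑ x ∈ Finset.Ico i j ×ˢ Finset.Icc 1 d, p x = (W j - W i) / (W s - W 1) := by
    intro i j hi hij hj
    rw [Finset.sum_product_right, Finset.sum_congr rfl fun a ha =>
      hcol i j hi hij hj a (Finset.mem_Icc.1 ha).1 (Finset.mem_Icc.1 ha).2,
      ← Finset.sum_div, ← Finset.mul_sum, (h0 i j hi hij hj).2, mul_one]
  obtain ⟨Z, hZ, hZS, hZT⟩ := exists_measurable_of_weights
    (Finset.Ico 1 s ×ˢ Finset.Icc 1 d) p (by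
      rintro ⟨m, a⟩ hx
      simp only [Finset.mem_product, Finset.mem_Ico, Finset.mem_Icc] at hx
      have hm := hWF m (m + 1) hx.1.1 (by omega) (by omega)
      simp only [hp, hm.2 a hx.2.1 hx.2.2]
      exact div_nonneg (mul_nonneg (sub_pos.2 hm.1).le
        ((h0 m (m + 1) hx.1.1 (by omega) (by omega)).1 a hx.2.1 hx.2.2).1) hL.le)
    (by rw [hblock 1 s le_rfl (by omega) le_rfl, div_self hL.ne'])
  simp only [Finset.mem_product, Finset.mem_Ico, Finset.mem_Icc] at hZS
  refine ⟨fun t => (Z t).1 + 1, fun t => (Z t).2, by fun_prop, by fun_prop,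
    fun t _ => ⟨Nat.le_add_left 1 _, (hZS t).1.2⟩, fun t _ => (hZS t).2, ?_⟩
  intro i j hi hij hj
  have hW : 0 < W j - W i := sub_pos.2 (hWF i j hi hij hj).1
  have hX : {t | i < (Z t).1 + 1 ∧ (Z t).1 + 1 ≤ j} =
      Z ⁻¹' ↑(Finset.Ico i j ×ˢ Finset.Icc 1 d) := by
    ext t
    have := hZS t
    simp only [Set.mem_ofPred_eq, Set.mem_preimage, Finset.mem_coe, Finset.mem_product,
      Finset.mem_Ico, Finset.mem_Icc]
    omega
  have hIco : Finset.Ico i j ⊆ Finset.Ico 1 s := Finset.Ico_subset_Ico hi hj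
  rw [hX, hZT _ (Finset.product_subset_product_left hIco), hblock i j hi hij hj]
  refine ⟨ENNReal.ofReal_pos.2 (div_pos hW hL), fun a ha had => ?_⟩
  have hXY : {t | (Z t).2 = a ∧ i < (Z t).1 + 1 ∧ (Z t).1 + 1 ≤ j} =
      Z ⁻¹' ↑(Finset.Ico i j ×ˢ {a}) := by
    ext t
    simp only [Set.mem_ofPred_eq, Set.mem_preimage, Finset.mem_coe, Finset.mem_product,
      Finset.mem_Ico, Finset.mem_singleton]
    omega
  rw [hXY, hZT _ (Finset.product_subset_product hIco (by simp [ha, had])),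
    Finset.sum_product_right, Finset.sum_singleton, hcol i j hi hij hj a ha had,
    ENNReal.toReal_ofReal (div_pos hW hL).le,
    ENNReal.toReal_ofReal (div_nonneg (mul_nonneg hW.le ((h0 i j hi hij hj).1 a ha had).1) hL.le)]
  field_simp
end
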